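/- Let (S, A) be random variables on a probability space, Q : S × A → ℝ bounded measurable, and for each s let Q̂(s) := E[Q(s, A) | some sub-σ-algebra generated by a component A₁ of A] be the conditional expectation of Q over the remaining components. Let g : S × A₁ → ℝ^n be a bounded function of s and the component A₁ only. If the components A₁ and A₂ = A \ A₁ are conditionally independent given S, then E[(Q(S, A) − Q̂(S, A₁))·g(S, A₁)] = 0. -/

import Mathlib

open MeasureTheory ProbabilityTheory

/-- If `X` and `Y` are conditionally independent given `Z`, then `(condDistrib Y Z μ).prodMkRight`
disintegrates the joint law of `((Z, X), Y)`. No standard Borel assumption is made on the codomain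
of `X`. -/
lemma ProbabilityTheory.CondIndepFun.map_prodMk_eq_compProd_prodMkRight
    {Ω α β γ : Type*} {mΩ : MeasurableSpace Ω} [StandardBorelSpace Ω]
    {mα : MeasurableSpace α} {mβ : MeasurableSpace β} {mγ : MeasurableSpace γ}
    [StandardBorelSpace β] [Nonempty β]
    {μ : Measure Ω} [IsFiniteMeasure μ] {X : Ω → α} {Y : Ω → β} {Z : Ω → γ}
    (hX : Measurable X) (hY : Measurable Y) (hZ : Measurable Z)
    (h : CondIndepFun (mγ.comap Z) hZ.comap_le X Y μ) :
    μ.map (fun ω ↦ ((Z ω, X ω), Y ω)) =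
      μ.map (fun ω ↦ (Z ω, X ω)) ⊗ₘ (condDistrib Y Z μ).prodMkRight α := by
  refine Measure.ext_prod₃_iff'.2 fun {s t u} hs ht hu ↦ ?_
  set κ : Ω → ℝ := fun ω ↦ (condDistrib Y Z μ (Z ω)).real u
  have hκ_meas : StronglyMeasurable[mγ.comap Z] κ :=
    (measurable_condDistrib hu).ennreal_toReal.stronglyMeasurable
  have hκ_int : Integrable κ μ := integrable_toReal_condDistrib hZ.aemeasurable hu
  have hmul : (X ⁻¹' t).indicator κ = (X ⁻¹' t).indicator (fun _ ↦ (1 : ℝ)) * κ := by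
    ext ω
    by_cases hω : ω ∈ X ⁻¹' t <;> simp [hω]
  have hcond : μ⟦X ⁻¹' t ∩ Y ⁻¹' u | mγ.comap Z⟧ =ᵐ[μ]
      μ[(X ⁻¹' t).indicator κ | mγ.comap Z] := by
    have hpull := condExp_mul_of_stronglyMeasurable_right (μ := μ) hκ_meas
      (hmul ▸ hκ_int.indicator (hX ht)) ((integrable_const (1 : ℝ)).indicator (hX ht))
    rw [hmul]
    filter_upwards [(condIndepFun_iff_condExp_inter_preimage_eq_mul hX hY).1 h t u ht hu, hpull,
      condDistrib_ae_eq_condExp hZ hY hu] with ω h1 h2 h3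
    rw [h1, h2, ← h3]
    rfl
  have hreal : μ.real (Z ⁻¹' s ∩ (X ⁻¹' t ∩ Y ⁻¹' u)) = ∫ ω in Z ⁻¹' s ∩ X ⁻¹' t, κ ω ∂μ := by
    have hsZ : MeasurableSet[mγ.comap Z] (Z ⁻¹' s) := ⟨s, hs, rfl⟩
    calc μ.real (Z ⁻¹' s ∩ (X ⁻¹' t ∩ Y ⁻¹' u))
    _ = ∫ ω in Z ⁻¹' s, (X ⁻¹' t ∩ Y ⁻¹' u).indicator (fun _ ↦ (1 : ℝ)) ω ∂μ := by
      rw [setIntegral_indicator ((hX ht).inter (hY hu))]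
      simp
    _ = ∫ ω in Z ⁻¹' s, (μ⟦X ⁻¹' t ∩ Y ⁻¹' u | mγ.comap Z⟧) ω ∂μ :=
      (setIntegral_condExp hZ.comap_le
        ((integrable_const (1 : ℝ)).indicator ((hX ht).inter (hY hu))) hsZ).symm
    _ = ∫ ω in Z ⁻¹' s, (μ[(X ⁻¹' t).indicator κ | mγ.comap Z]) ω ∂μ :=
      integral_congr_ae (ae_restrict_of_ae hcond)
    _ = ∫ ω in Z ⁻¹' s, (X ⁻¹' t).indicator κ ω ∂μ :=
      setIntegral_condExp hZ.comap_le (hκ_int.indicator (hX ht)) hsZ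
    _ = ∫ ω in Z ⁻¹' s ∩ X ⁻¹' t, κ ω ∂μ := setIntegral_indicator (hX ht)
  have hpre : (fun ω ↦ ((Z ω, X ω), Y ω)) ⁻¹' ((s ×ˢ t) ×ˢ u) =
      Z ⁻¹' s ∩ (X ⁻¹' t ∩ Y ⁻¹' u) := by
    ext ω
    simp [and_assoc]
  have hmeas : Measurable fun ω ↦ condDistrib Y Z μ (Z ω) u :=
    (Kernel.measurable_coe _ hu).comp hZ
  rw [← ENNReal.toReal_eq_toReal_iff' (by finiteness) (by finiteness),
    Measure.map_apply (by fun_prop) ((hs.prod ht).prod hu), hpre,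
    Measure.compProd_apply_prod (hs.prod ht) hu,
    setLIntegral_map (hs.prod ht) (Kernel.measurable_coe _ hu) (by fun_prop)]
  simp only [Kernel.prodMkRight_apply]
  rw [← integral_toReal hmeas.aemeasurable (by simp), Set.mk_preimage_prod]
  exact hreal

/-- If `A₁` and `A₂` are conditionally independent given `S`, `Q` is bounded measurable,
`Q̂ (s, a₁) = E[Q (s, a₁, A₂) | S = s]` (computed via the regular conditional distribution of
`A₂` given `S`), and `g` is a bounded measurable function of `(S, A₁)` only, then
`E[(Q(S,A) − Q̂(S,A₁)) • g(S,A₁)] = 0`. -/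
theorem advantage_orthogonal_to_local_score
    {Ω : Type*} [hΩ : MeasureSpace Ω] [StandardBorelSpace Ω] [Nonempty Ω]
    [IsProbabilityMeasure (ℙ : Measure Ω)]
    {𝒮 𝒜₁ 𝒜₂ : Type*} [MeasurableSpace 𝒮] [MeasurableSpace 𝒜₁] [MeasurableSpace 𝒜₂]
    [StandardBorelSpace 𝒜₂] [Nonempty 𝒜₂] {n : ℕ}
    (S : Ω → 𝒮) (A₁ : Ω → 𝒜₁) (A₂ : Ω → 𝒜₂)
    (hS : Measurable S) (hA₁ : Measurable A₁) (hA₂ : Measurable A₂)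
    (Q : 𝒮 → 𝒜₁ → 𝒜₂ → ℝ) (g : 𝒮 → 𝒜₁ → EuclideanSpace ℝ (Fin n))
    (hQmeas : Measurable fun p : 𝒮 × 𝒜₁ × 𝒜₂ => Q p.1 p.2.1 p.2.2)
    (hgmeas : Measurable fun p : 𝒮 × 𝒜₁ => g p.1 p.2)
    (CQ : ℝ) (hQbd : ∀ s a₁ a₂, |Q s a₁ a₂| ≤ CQ)
    (Cg : ℝ) (hgbd : ∀ s a₁, ‖g s a₁‖ ≤ Cg)
    (hci : CondIndepFun (MeasurableSpace.comap S inferInstance) (hS.comap_le) A₁ A₂ ℙ) :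
    ∫ ω, (Q (S ω) (A₁ ω) (A₂ ω)
        - ∫ a₂, Q (S ω) (A₁ ω) a₂ ∂(condDistrib A₂ S ℙ (S ω)))
      • g (S ω) (A₁ ω) ∂(ℙ : Measure Ω) = 0 := by
  set κ := condDistrib A₂ S (ℙ : Measure Ω)
  let F : (𝒮 × 𝒜₁) × 𝒜₂ → EuclideanSpace ℝ (Fin n) := fun p ↦
    (Q p.1.1 p.1.2 p.2 - ∫ a₂, Q p.1.1 p.1.2 a₂ ∂(κ p.1.1)) • g p.1.1 p.1.2
  have hQ : StronglyMeasurable fun p : (𝒮 × 𝒜₁) × 𝒜₂ ↦ Q p.1.1 p.1.2 p.2 :=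
    (hQmeas.comp MeasurableEquiv.prodAssoc.measurable).stronglyMeasurable
  have hQhat : StronglyMeasurable fun p : 𝒮 × 𝒜₁ ↦ ∫ a₂, Q p.1 p.2 a₂ ∂(κ p.1) :=
    hQ.integral_kernel_prod_right' (κ := κ.prodMkRight 𝒜₁)
  have hF : StronglyMeasurable F :=
    (hQ.sub (hQhat.comp_measurable measurable_fst)).smul
      (hgmeas.comp measurable_fst).stronglyMeasurable
  have hQint (s : 𝒮) (a₁ : 𝒜₁) : Integrable (Q s a₁) (κ s) :=
    .of_bound (hQ.comp_measurable (measurable_prodMk_left (x := (s, a₁)))).aestronglyMeasurable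
      CQ (ae_of_all _ (hQbd s a₁))
  have hFbd (p) : ‖F p‖ ≤ (CQ + CQ) * Cg := by
    have hQhat_bd : ‖∫ a₂, Q p.1.1 p.1.2 a₂ ∂(κ p.1.1)‖ ≤ CQ := by
      simpa using norm_integral_le_of_norm_le_const (μ := κ p.1.1) (f := Q p.1.1 p.1.2)
        (ae_of_all _ (hQbd p.1.1 p.1.2))
    have hdiff := (norm_sub_le (Q p.1.1 p.1.2 p.2) _).trans
      (add_le_add (hQbd p.1.1 p.1.2 p.2) hQhat_bd)
    exact (norm_smul_le _ _).trans
      (mul_le_mul hdiff (hgbd _ _) (norm_nonneg _) ((norm_nonneg _).trans hdiff))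
  calc ∫ ω, F ((S ω, A₁ ω), A₂ ω) ∂(ℙ : Measure Ω)
  _ = ∫ p, F p ∂((ℙ : Measure Ω).map (fun ω ↦ (S ω, A₁ ω)) ⊗ₘ κ.prodMkRight 𝒜₁) := by
    rw [← hci.map_prodMk_eq_compProd_prodMkRight hA₁ hA₂ hS,
      integral_map (by fun_prop) hF.aestronglyMeasurable]
  _ = ∫ q, ∫ a₂, F (q, a₂) ∂(κ q.1) ∂((ℙ : Measure Ω).map (fun ω ↦ (S ω, A₁ ω))) :=
    Measure.integral_compProd
      (.of_bound hF.aestronglyMeasurable ((CQ + CQ) * Cg) (ae_of_all _ hFbd))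
  _ = 0 := by
    refine integral_eq_zero_of_ae (ae_of_all _ fun q ↦ ?_)
    simp only [F, Pi.zero_apply]
    rw [integral_smul_const, integral_sub (hQint _ _) (integrable_const _)]
    simp
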